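/- arXiv:1310.4353 — 2 statements merged into one kernel-verified Lean document; each statement's English description precedes it below -/
import Mathlib

section
/- Let m₁, m₂, a₁, a₂ be integers with m₁, m₂ ≥ 2, 0 < a₁ < m₁, 0 < a₂ < m₂, gcd(m₁,a₁) = 1, gcd(m₂,a₂) = 1, and δ := m₁a₂ + m₂a₁ − m₁m₂ > 0. If m₂ = δm₁, then δ = m₁, m₂ = δ², a₂ = δ² − δa₁ + 1, and Δ := m₁² + m₂² − δm₁m₂ equals δ². -/
/-- divisorial case of a k2A extremal neighborhood. If
`δ = m₁a₂ + m₂a₁ - m₁m₂ > 0` and `m₂ = δm₁`, then `δ = m₁`, `m₂ = δ²`,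
`a₂ = δ² - δa₁ + 1`, and `Δ = m₁² + m₂² - δm₁m₂ = δ²`. -/
theorem k2A_divisorial_case (m₁ m₂ a₁ a₂ δ : ℤ)
    (hm₁ : 2 ≤ m₁) (hm₂ : 2 ≤ m₂)
    (ha₁ : 0 < a₁) (ham₁ : a₁ < m₁) (ha₂ : 0 < a₂) (ham₂ : a₂ < m₂)
    (hgcd₁ : Int.gcd m₁ a₁ = 1) (hgcd₂ : Int.gcd m₂ a₂ = 1)
    (hδdef : δ = m₁ * a₂ + m₂ * a₁ - m₁ * m₂) (hδ : 0 < δ)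
    (h : m₂ = δ * m₁) :
    δ = m₁ ∧ m₂ = δ ^ 2 ∧ a₂ = δ ^ 2 - δ * a₁ + 1 ∧
      m₁ ^ 2 + m₂ ^ 2 - δ * m₁ * m₂ = δ ^ 2 := by
  obtain ⟨k, hk⟩ : m₁ ∣ δ := ⟨a₂ + δ * a₁ - δ * m₁, by linear_combination hδdef + (a₁ - m₁) * h⟩
  have ha : a₂ = k * (1 + m₁ * (m₁ - a₁)) := by
    apply mul_left_cancel₀ (show m₁ ≠ 0 by omega)
    linear_combination -hδdef + (m₁ - a₁) * h + (1 + m₁ * (m₁ - a₁)) * hk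
  have hk_unit : IsUnit k :=
    (Int.isCoprime_iff_gcd_eq_one.mpr hgcd₂).isUnit_of_dvd'
      ⟨m₁ * m₁, by rw [h, hk]; ring⟩ ⟨_, ha⟩
  have hk_pos : 0 < k := pos_of_mul_pos_right (hk ▸ hδ) (by omega)
  obtain rfl : k = 1 := by
    rcases Int.isUnit_iff.mp hk_unit with hk_one | hk_neg <;> omega
  obtain rfl : δ = m₁ := by simpa using hk
  refine ⟨rfl, ?_, ?_, ?_⟩
  · rw [h, sq]
  · rw [ha]; ring
  · rw [h]; ring
end

section
/- Let m ≥ 2, 0 < a < m, gcd(m,a) = 1, and let m²/(ma−1) = [e₁,…,e_s] be the Hirzebruch–Jung expansion of the Wahl singularity 1/m²(1, ma−1). Let 1 ≤ i ≤ s be such that e_i ≥ 3 and e_j = 2 for all j > i. Then (ma+1)/a² = [e₁,…,e_{i−1}, e_i − 1] as rational numbers; moreover, if a > 1, then 0 < ae₁ − m < a and a²/(a(ae₁ − m) − 1) = [e₂,…,e_{i−1}, e_i − 1] as rational numbers. -/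
/-- Hirzebruch–Jung continued fraction `[b i, b (i+1), …, b (i+n-1)]` (`n` terms):
`hjCF b i n = b i - 1/(b (i+1) - 1/(⋯ - 1/(b (i+n-1))))`, with the conventions
`hjCF b i 0 = 0` and `(0 : ℚ)⁻¹ = 0`. -/
def hjCF (b : ℕ → ℤ) : ℕ → ℕ → ℚ
  | _, 0 => 0
  | i, n + 1 => (b i : ℚ) - (hjCF b (i + 1) n)⁻¹

/-- The continued fraction `[b i, …, b (i+n-1)]` is well defined:
no partial denominator vanishes. -/
def hjWD (b : ℕ → ℤ) : ℕ → ℕ → Prop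
  | _, 0 => True
  | i, n + 1 => (n = 0 ∨ hjCF b (i + 1) n ≠ 0) ∧ hjWD b (i + 1) n

/-- The sequence `x 0 = x0`, `x 1 = x1`, `x (i+1) = b i * x i - x (i-1)` for `i ≥ 1`. -/
def rec2 (x0 x1 : ℤ) (b : ℕ → ℤ) : ℕ → ℤ
  | 0 => x0
  | 1 => x1
  | i + 2 => b (i + 1) * rec2 x0 x1 b (i + 1) - rec2 x0 x1 b i

theorem hjCF_two (e : ℕ → ℤ) (n j : ℕ) (h : ∀ l, j ≤ l → l < j + n → e l = 2) :
    hjCF e j n = ((n : ℚ) + 1) / n := by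
  induction n generalizing j with
  | zero => simp [hjCF]
  | succ n ih =>
    have hn : (n : ℚ) + 1 ≠ 0 := by positivity
    rw [hjCF, ih (j + 1) fun l h1 h2 => h l (by lia) (by lia), h j le_rfl (by lia), inv_div]
    push_cast
    field_simp
    ring

/-- Consecutive convergents `p / q` and `p' / q'` of a continued fraction whose entries after
index `j + k` all equal `2`; the difference `(p - p') / (q - q')` is the value obtained by
truncating at index `j + k` and lowering that entry by one. -/
theorem exists_hjCF_convergents (e : ℕ → ℤ) (t k j : ℕ)
    (he : ∀ l, j ≤ l → l < j + k → 2 ≤ e l) (hk : 3 ≤ e (j + k))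
    (h2 : ∀ l, j + k < l → l ≤ j + k + t → e l = 2) :
    ∃ p p' q q' : ℤ, hjCF e j (k + 1 + t) = (p : ℚ) / q ∧
      hjCF (fun l => if l = j + k then e (j + k) - 1 else e l) j (k + 1) =
        ((p - p' : ℤ) : ℚ) / ((q - q' : ℤ) : ℚ) ∧
      p' * q - p * q' = 1 ∧ q' ≤ p' ∧ 0 ≤ p' ∧ 0 < q ∧ q < p ∧ 0 < q - q' ∧
      q - q' < p - p' := by
  induction k generalizing j with
  | zero =>
    have ht : (t : ℚ) + 1 ≠ 0 := by positivity
    have ht0 : (0 : ℤ) ≤ t := by positivity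
    simp only [add_zero] at hk h2 ⊢
    refine ⟨e j * (t + 1) - t, e j * t - (t - 1), t + 1, t, ?_, ?_, by ring, by nlinarith,
      by nlinarith, by lia, by nlinarith, by lia, by nlinarith⟩
    · rw [show 0 + 1 + t = t + 1 by ring, hjCF,
        hjCF_two e t (j + 1) fun l h1 h3 => h2 l (by lia) (by lia), inv_div]
      push_cast
      field_simp
    · simp [hjCF]
      ring
  | succ k ih =>
    rw [show j + (k + 1) = j + 1 + k by ring] at *
    obtain ⟨p, p', q, q', hpq, hd, hdet, h1, h3, h4, h5, h6, h7⟩ :=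
      ih (j + 1) (fun l h1 h2 => he l (by lia) (by lia)) hk h2
    have hj := he j le_rfl (by lia)
    have hp : (p : ℚ) ≠ 0 := by exact_mod_cast (show p ≠ 0 by lia)
    have hpp : ((p - p' : ℤ) : ℚ) ≠ 0 := by exact_mod_cast (show p - p' ≠ 0 by lia)
    refine ⟨e j * p - q, e j * p' - q', p, p', ?_, ?_, by linarith, by nlinarith, by nlinarith,
      by lia, by nlinarith, by lia, by nlinarith⟩
    · rw [show k + 1 + 1 + t = k + 1 + t + 1 by ring, hjCF, hpq, inv_div]
      push_cast
      field_simp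
    · rw [hjCF, hd, if_neg (by lia), inv_div, eq_div_iff hpp, sub_mul, div_mul_cancel₀ _ hpp]
      push_cast
      ring

theorem eq_of_div_eq_div_of_isCoprime {p q r s : ℤ} (hq : 0 < q) (hs : 0 < s)
    (hpq : IsCoprime p q) (hrs : IsCoprime r s) (h : (p : ℚ) / q = (r : ℚ) / s) :
    p = r ∧ q = s :=
  Rat.div_int_inj hq hs (Int.isCoprime_iff_nat_coprime.1 hpq)
    (Int.isCoprime_iff_nat_coprime.1 hrs) h

/-- for the Wahl singularity `m²/(ma-1) = [e₁,…,e_s]`, if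
`e_i ≥ 3` and `e_j = 2` for all `j > i`, then
`(ma+1)/a² = [e₁,…,e_{i-1}, e_i - 1]`; moreover if `a > 1` then
`0 < ae₁ - m < a` and `a²/(a(ae₁ - m) - 1) = [e₂,…,e_{i-1}, e_i - 1]`. -/
theorem special_flip_fractions (m a : ℤ) (s i : ℕ) (e : ℕ → ℤ)
    (hm : 2 ≤ m) (ha : 0 < a) (ham : a < m) (hgcd : Int.gcd m a = 1)
    (hs : 1 ≤ s) (he : ∀ j, 1 ≤ j → j ≤ s → 2 ≤ e j)
    (hexp : hjCF e 1 s = (m : ℚ) ^ 2 / ((m : ℚ) * (a : ℚ) - 1))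
    (hi1 : 1 ≤ i) (his : i ≤ s) (hei : 3 ≤ e i)
    (he2 : ∀ j, i < j → j ≤ s → e j = 2) :
    ((m * a + 1 : ℤ) : ℚ) / ((a ^ 2 : ℤ) : ℚ) =
      hjCF (fun j => if j = i then e i - 1 else e j) 1 i ∧
    (1 < a →
      0 < a * e 1 - m ∧ a * e 1 - m < a ∧
      ((a ^ 2 : ℤ) : ℚ) / ((a * (a * e 1 - m) - 1 : ℤ) : ℚ) =
        hjCF (fun j => if j = i then e i - 1 else e j) 2 (i - 1)) := by
  obtain ⟨k, rfl⟩ : ∃ k, i = 1 + k := ⟨i - 1, by lia⟩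
  obtain ⟨t, rfl⟩ : ∃ t, s = k + 1 + t := ⟨s - (k + 1), by lia⟩
  obtain ⟨p, p', q, q', hpq, hd, hdet, -, h3, h4, h5, h6, h7⟩ :=
    exists_hjCF_convergents e t k 1 (fun l h1 h2 => he l h1 (by lia)) hei
      fun l h1 h2 => he2 l h1 (by lia)
  have hma : 0 < m * a - 1 := by nlinarith
  have hcop : IsCoprime (m ^ 2) (m * a - 1) := ⟨a ^ 2, -(m * a + 1), by ring⟩
  obtain ⟨rfl, rfl⟩ : p = m ^ 2 ∧ q = m * a - 1 :=
    eq_of_div_eq_div_of_isCoprime h4 hma ⟨-q', p', by linarith⟩ hcop <| by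
      rw [← hpq, hexp]
      push_cast
      rfl
  have hdvd : m ^ 2 ∣ p' - (m ^ 2 - m * a - 1) :=
    hcop.dvd_of_dvd_mul_right ⟨q' - (m * a - a ^ 2 - 1), by linear_combination hdet⟩
  have hp' : p' = m ^ 2 - m * a - 1 := by
    have := Int.eq_zero_of_abs_lt_dvd hdvd (by rw [abs_lt]; constructor <;> nlinarith)
    lia
  have hq' : q' = m * a - a ^ 2 - 1 := by
    have hm2 : m ^ 2 ≠ 0 := by positivity
    apply mul_left_cancel₀ hm2
    subst hp'
    linear_combination -hdet
  rw [show m ^ 2 - p' = m * a + 1 by lia, show m * a - 1 - q' = a ^ 2 by lia] at hd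
  refine ⟨by rw [← hd, add_comm 1 k], fun ha1 => ?_⟩
  have ha2 : ((a ^ 2 : ℤ) : ℚ) ≠ 0 := by exact_mod_cast (show a ^ 2 ≠ 0 by positivity)
  obtain _ | k := k
  · have hv : ((m * a + 1 : ℤ) : ℚ) / ((a ^ 2 : ℤ) : ℚ) = ((e 1 - 1 : ℤ) : ℚ) := by
      rw [← hd]
      simp [hjCF]
    rw [div_eq_iff ha2] at hv
    have hv' : m * a + 1 = (e 1 - 1) * a ^ 2 := by exact_mod_cast hv
    have : a ∣ 1 := ⟨(e 1 - 1) * a - m, by linear_combination hv'⟩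
    have := Int.le_of_dvd one_pos this
    lia
  · rw [show 1 + (k + 1) = 2 + k by ring] at *
    obtain ⟨r, r', u, u', -, hd2, -, -, -, -, -, hu, hur⟩ :=
      exists_hjCF_convergents e t k 2 (fun l h1 h2 => he l (by lia) (by lia)) hei
        fun l h1 h2 => he2 l h1 (by lia)
    rw [show 2 + k - 1 = k + 1 by lia]
    rw [hjCF, if_neg (by lia)] at hd
    set x := hjCF (fun j => if j = 2 + k then e (2 + k) - 1 else e j) 2 (k + 1)
    have hx : 1 < x := by
      rw [hd2, one_lt_div (by exact_mod_cast hu)]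
      exact_mod_cast hur
    have hxinv : x⁻¹ = ((a * (a * e 1 - m) - 1 : ℤ) : ℚ) / ((a ^ 2 : ℤ) : ℚ) := by
      rw [eq_div_iff ha2]
      rw [eq_div_iff ha2, sub_mul] at hd
      push_cast at hd ⊢
      linear_combination -hd
    have ha2pos : (0 : ℚ) < ((a ^ 2 : ℤ) : ℚ) := by exact_mod_cast (show 0 < a ^ 2 by positivity)
    have hpos : 0 < x⁻¹ := by positivity
    have hlt : x⁻¹ < 1 := inv_lt_one_of_one_lt₀ hx
    rw [hxinv, div_pos_iff_of_pos_right ha2pos] at hpos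
    rw [hxinv, div_lt_one ha2pos] at hlt
    have hpos' : 0 < a * (a * e 1 - m) - 1 := by exact_mod_cast hpos
    have hlt' : a * (a * e 1 - m) - 1 < a ^ 2 := by exact_mod_cast hlt
    refine ⟨by nlinarith, lt_of_le_of_ne (by nlinarith) fun h => ?_, ?_⟩
    · have hdm : a ∣ m := ⟨e 1 - 1, by linear_combination -h⟩
      have := Int.isCoprime_iff_gcd_eq_one.2 hgcd
      have := Int.le_of_dvd one_pos (this.symm.dvd_of_dvd_mul_left (by simpa using hdm))
      lia
    · rw [← inv_inv x, hxinv, inv_div]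
end
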